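/- Let R be a commutative ring containing the field of rational numbers and let φ : R^m → R^n and ψ : R^p → R^q be R-linear maps. Then I(φ ⊗ ψ) = I(φ)^q · I(ψ)^n. -/

import Mathlib

noncomputable section

/-- `I_t(A)`: the ideal of `R` generated by the `t × t` minors of the matrix `A`. -/
def minorsIdeal {R : Type*} [CommRing R] (t : ℕ) {N M : Type*} (A : Matrix N M R) : Ideal R :=
  Ideal.span {x : R | ∃ (r : Fin t → N) (c : Fin t → M), x = (A.submatrix r c).det}

section KroneckerMinors

open Matrix Equiv Finset

variable {R : Type*} [CommRing R] {ι κ : Type*} [Fintype ι] [DecidableEq ι] [Fintype κ]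
  [DecidableEq κ]

theorem prod_det_eq_sum_prodCongrLeft (Z : κ → ι → ι → R) :
    ∏ j, (of (Z j)).det = ∑ α : κ → Perm ι, ((Perm.sign (prodCongrLeft α) : ℤ) : R) *
      ∏ k : ι × κ, Z k.2 k.1 (α k.2 k.1) := by
  simp only [← det_transpose (of (Z _)), det_apply', Finset.prod_univ_sum, Fintype.piFinset_univ,
    Finset.prod_mul_distrib, Perm.sign_prodCongrLeft, Fintype.prod_prod_type_right,
    transpose_apply, of_apply]
  push_cast
  rfl

theorem prod_det_eq_sum_prodCongrRight (Z : ι → κ → κ → R) :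
    ∏ i, (of (Z i)).det = ∑ β : ι → Perm κ, ((Perm.sign (prodCongrRight β) : ℤ) : R) *
      ∏ k : ι × κ, Z k.1 k.2 (β k.1 k.2) := by
  simp only [← det_transpose (of (Z _)), det_apply', Finset.prod_univ_sum, Fintype.piFinset_univ,
    Finset.prod_mul_distrib, Perm.sign_prodCongrRight, Fintype.prod_prod_type,
    transpose_apply, of_apply]
  push_cast
  rfl

theorem det_submatrix_id_eq_mul (A : Matrix ι ι R) (f : ι → ι) :
    (A.submatrix id f).det = A.det * ((1 : Matrix ι ι R).submatrix id f).det := by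
  rw [← det_mul]
  congr 1
  ext i j
  simp [mul_apply, one_apply]

theorem intCast_det_one_submatrix (f : ι → ι) :
    ((((1 : Matrix ι ι ℤ).submatrix id f).det : ℤ) : R) =
      ((1 : Matrix ι ι R).submatrix id f).det := by
  rw [Int.cast_det]
  congr 1
  ext i j
  simp [one_apply]

variable (ι κ) in
/-- The constant relating maximal minors of a Kronecker product to products of maximal minors of
its factors. -/
def kroneckerMinorConst : ℤ :=
  ∑ α : κ → Perm ι, ∑ β : ι → Perm κ,
    (Perm.sign (prodCongrLeft α) : ℤ) * (Perm.sign (prodCongrRight β) : ℤ) *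
      ((1 : Matrix (ι × κ) (ι × κ) ℤ).submatrix id fun k => (α k.2 k.1, β k.1 k.2)).det

theorem sum_sign_mul_prod_det_mul_prod_det (X : ι × κ → ι → R) (Y : ι × κ → κ → R) :
    ∑ τ : Perm (ι × κ), ((Perm.sign τ : ℤ) : R) *
      ((∏ j, (of fun i i' => X (τ (i, j)) i').det) *
        ∏ i, (of fun j j' => Y (τ (i, j)) j').det) =
      kroneckerMinorConst ι κ * (of fun k l : ι × κ => X k l.1 * Y k l.2).det := by
  simp_rw [prod_det_eq_sum_prodCongrLeft (ι := ι) (κ := κ),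
    prod_det_eq_sum_prodCongrRight (ι := ι) (κ := κ), sum_mul_sum, mul_sum]
  rw [sum_comm]
  rw [kroneckerMinorConst, Int.cast_sum, sum_mul]
  refine sum_congr rfl fun α _ => ?_
  rw [sum_comm, Int.cast_sum, sum_mul]
  refine sum_congr rfl fun β _ => ?_
  rw [Int.cast_mul, Int.cast_mul, intCast_det_one_submatrix, mul_assoc, mul_comm (det _),
    ← det_submatrix_id_eq_mul, det_apply', mul_sum]
  refine sum_congr rfl fun τ _ => ?_
  simp only [of_apply, submatrix_apply, id, prod_mul_distrib]
  ring

theorem sum_sign_mul_det_kronecker (U : ι × κ → ι → R) (V : ι × κ → κ → R) :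
    ∑ α : κ → Perm ι, ∑ β : ι → Perm κ,
      ((Perm.sign (prodCongrLeft α) : ℤ) : R) * ((Perm.sign (prodCongrRight β) : ℤ) : R) *
        (of fun l k : ι × κ => U (α k.2 k.1, k.2) l.1 * V (k.1, β k.1 k.2) l.2).det =
      kroneckerMinorConst ι κ * ((∏ j, (of fun i i' => U (i, j) i').det) *
        ∏ i, (of fun j j' => V (i, j) j').det) := by
  have h := sum_sign_mul_prod_det_mul_prod_det (R := R)
    (fun (k : ι × κ) i => (1 : Matrix ι ι R) i k.1) (fun k j => (1 : Matrix κ κ R) j k.2)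
  have h1 : (of fun k l : ι × κ => (1 : Matrix ι ι R) l.1 k.1 * (1 : Matrix κ κ R) l.2 k.2) =
      1 := by
    ext k l
    simp [one_apply, Prod.ext_iff, ← ite_and, eq_comm, and_comm]
  rw [h1, det_one, mul_one] at h
  rw [← h, sum_mul]
  simp only [det_apply' (n := ι × κ), of_apply, mul_sum]
  rw [sum_congr rfl fun α _ => sum_comm, sum_comm]
  refine sum_congr rfl fun τ _ => ?_
  have hU (j : κ) : (of fun i i' => (1 : Matrix ι ι R) i' (τ (i, j)).1).det *
      (of fun i i' => U (i, j) i').det = (of fun i i' => U (i', j) (τ (i, j)).1).det := by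
    rw [← det_transpose (of fun i i' => U (i, j) i'), ← det_mul]
    congr 1
    ext i i'
    simp [mul_apply, one_apply]
  have hV (i : ι) : (of fun j j' => (1 : Matrix κ κ R) j' (τ (i, j)).2).det *
      (of fun j j' => V (i, j) j').det = (of fun j j' => V (i, j') (τ (i, j)).2).det := by
    rw [← det_transpose (of fun j j' => V (i, j) j'), ← det_mul]
    congr 1
    ext j j'
    simp [mul_apply, one_apply]
  rw [mul_assoc, mul_mul_mul_comm, ← prod_mul_distrib, ← prod_mul_distrib]
  simp_rw [hU, hV]
  simp_rw [prod_det_eq_sum_prodCongrLeft (ι := ι) (κ := κ),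
    prod_det_eq_sum_prodCongrRight (ι := ι) (κ := κ), sum_mul_sum, mul_sum]
  refine sum_congr rfl fun α _ => sum_congr rfl fun β _ => ?_
  simp only [prod_mul_distrib]
  ring

/-- The product of the signs of the rows of an array, with value `0` if some row is not a
permutation. -/
def rowSign (g : ι × κ → κ) : ℤ :=
  ∏ i, ((1 : Matrix κ κ ℤ).submatrix id fun j => g (i, j)).det

theorem rowSign_eq_sum (g : ι × κ → κ) :
    rowSign g = ∑ β : ι → Perm κ, (Perm.sign (prodCongrRight β) : ℤ) *
      if (fun k => β k.1 k.2) = g then 1 else 0 := by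
  have hdet (i : ι) : ((1 : Matrix κ κ ℤ).submatrix id fun j => g (i, j)).det =
      (of fun j j' => (1 : Matrix κ κ ℤ) j' (g (i, j))).det := (det_transpose _).symm
  simp_rw [rowSign, hdet, prod_det_eq_sum_prodCongrRight]
  refine sum_congr rfl fun β _ => ?_
  simp [one_apply, Finset.prod_ite_zero, funext_iff]

theorem det_one_submatrix_fst (g : ι × κ → κ) :
    ((1 : Matrix (ι × κ) (ι × κ) ℤ).submatrix id fun k => (k.1, g k)).det = rowSign g := by
  rw [rowSign, ← det_blockDiagonal, ← det_submatrix_equiv_self (Equiv.prodComm ι κ)]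
  congr 1
  ext k l
  simp only [submatrix_apply, id, one_apply, blockDiagonal_apply, Prod.ext_iff, ite_and,
    prodComm_apply, Prod.fst_swap, Prod.snd_swap]
  split_ifs <;> simp_all

theorem sum_rowSign_mul (h : (ι × κ → κ) → ℤ) :
    ∑ g, rowSign g * h g =
      ∑ β : ι → Perm κ, (Perm.sign (prodCongrRight β) : ℤ) * h fun k => β k.1 k.2 := by
  simp_rw [rowSign_eq_sum, sum_mul]
  rw [sum_comm]
  simp

theorem kroneckerMinorConst_eq_sum_rowSign :
    kroneckerMinorConst ι κ = ∑ α : κ → Perm ι, ∑ g : ι × κ → κ,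
      rowSign g * rowSign (g ∘ (prodCongrLeft α).symm) := by
  refine sum_congr rfl fun α _ => ?_
  rw [sum_rowSign_mul]
  refine sum_congr rfl fun β _ => ?_
  rw [← det_one_submatrix_fst, mul_assoc,
    ← Perm.sign_symm (prodCongrLeft α),
    ← Int.cast_id (n := (Perm.sign (prodCongrLeft α).symm : ℤ)),
    mul_left_comm, ← det_permute']
  rw [submatrix_submatrix]
  congr 2
  exact congrArg (submatrix 1 id) (funext fun k => Prod.ext (apply_symm_apply _ _) rfl)

theorem kroneckerMinorConst_pos : 0 < kroneckerMinorConst ι κ := by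
  have key : ∑ g : ι × κ → κ, (∑ α : κ → Perm ι, rowSign (g ∘ (prodCongrLeft α).symm)) ^ 2 =
      Fintype.card (κ → Perm ι) * kroneckerMinorConst ι κ := by
    simp_rw [sq, sum_mul_sum]
    rw [sum_comm, ← nsmul_eq_mul, ← card_univ, ← sum_const]
    refine sum_congr rfl fun α _ => ?_
    rw [sum_comm, kroneckerMinorConst_eq_sum_rowSign, ← Equiv.sum_comp (Equiv.mulRight α)]
    refine sum_congr rfl fun γ _ => ?_
    exact Equiv.sum_comp ((prodCongrLeft α).arrowCongr (Equiv.refl κ))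
      fun g => rowSign g * rowSign (g ∘ (prodCongrLeft γ).symm)
  have hpos : 0 < ∑ g : ι × κ → κ,
      (∑ α : κ → Perm ι, rowSign (g ∘ (prodCongrLeft α).symm)) ^ 2 := by
    refine sum_pos' (fun g _ => sq_nonneg _) ⟨Prod.snd, mem_univ _, pow_pos ?_ 2⟩
    refine sum_pos (fun α _ => ?_) univ_nonempty
    have : (Prod.snd : ι × κ → κ) ∘ (prodCongrLeft α).symm = Prod.snd := rfl
    rw [this, rowSign]
    have : (fun j : κ => j) = id := rfl
    simp [this]
  rw [key] at hpos
  exact pos_of_mul_pos_right hpos (Nat.cast_nonneg _)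

theorem minorsIdeal_eq_span_range {t : ℕ} {M : Type*} (e : Fin t ≃ ι) (A : Matrix ι M R) :
    minorsIdeal t A = Ideal.span (Set.range fun c : ι → M => (A.submatrix id c).det) := by
  apply le_antisymm
  · rw [minorsIdeal, Ideal.span_le]
    rintro _ ⟨r, c, rfl⟩
    have : (A.submatrix r c).det = ((1 : Matrix ι ι R).submatrix (r ∘ e.symm) id).det *
        (A.submatrix id (c ∘ e.symm)).det := by
      rw [← det_mul, ← det_submatrix_equiv_self e]
      congr 1
      ext i j
      simp [mul_apply, one_apply]
    rw [this]
    exact Ideal.mul_mem_left _ _ (Ideal.subset_span ⟨_, rfl⟩)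
  · rw [Ideal.span_le]
    rintro _ ⟨c, rfl⟩
    refine Ideal.subset_span ⟨e, c ∘ e, ?_⟩
    exact (det_submatrix_equiv_self e _).symm

end KroneckerMinors

open scoped Kronecker in
/-- If `R` is a commutative ring containing `ℚ` and `φ : R^m → R^n`, `ψ : R^p → R^q` are
linear maps, then `I(φ ⊗ ψ) = I(φ)^q · I(ψ)^n`. -/
theorem maximalMinors_kronecker_eq {R : Type*} [CommRing R] [Algebra ℚ R] {m n p q : ℕ}
    (φ : Matrix (Fin n) (Fin m) R) (ψ : Matrix (Fin q) (Fin p) R) :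
    minorsIdeal (n * q) (φ ⊗ₖ ψ) = minorsIdeal n φ ^ q * minorsIdeal q ψ ^ n := by
  have hunit : IsUnit ((kroneckerMinorConst (Fin n) (Fin q) : ℤ) : R) := by
    have := (IsUnit.mk0 ((kroneckerMinorConst (Fin n) (Fin q) : ℤ) : ℚ)
      (by exact_mod_cast kroneckerMinorConst_pos.ne')).map (algebraMap ℚ R)
    simpa using this
  rw [minorsIdeal_eq_span_range finProdFinEquiv.symm, minorsIdeal_eq_span_range (Equiv.refl _) φ,
    minorsIdeal_eq_span_range (Equiv.refl _) ψ]
  apply le_antisymm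
  · rw [Ideal.span_le]
    rintro _ ⟨c, rfl⟩
    have h := sum_sign_mul_prod_det_mul_prod_det (fun k i => φ i (c k).1) (fun k j => ψ j (c k).2)
    rw [SetLike.mem_coe, ← Ideal.unit_mul_mem_iff_mem _ hunit]
    have hc : ((φ ⊗ₖ ψ).submatrix id c).det = (Matrix.of fun k l : Fin n × Fin q =>
        φ l.1 (c k).1 * ψ l.2 (c k).2).det := by
      rw [← Matrix.det_transpose]
      rfl
    beta_reduce
    rw [hc, ← h]
    refine Ideal.sum_mem _ fun τ _ => Ideal.mul_mem_left _ _ (Ideal.mul_mem_mul ?_ ?_)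
    · have := Ideal.prod_mem_prod (s := Finset.univ) (I := fun _ : Fin q => Ideal.span (Set.range
        fun c : Fin n → Fin m => (φ.submatrix id c).det)) (x := fun j =>
          (Matrix.of fun i i' => φ i' (c (τ (i, j))).1).det) fun j _ => by
        rw [← Matrix.det_transpose]
        exact Ideal.subset_span ⟨fun i => (c (τ (i, j))).1, rfl⟩
      simpa using this
    · have := Ideal.prod_mem_prod (s := Finset.univ) (I := fun _ : Fin n => Ideal.span (Set.range
        fun c : Fin q → Fin p => (ψ.submatrix id c).det)) (x := fun i =>
          (Matrix.of fun j j' => ψ j' (c (τ (i, j))).2).det) fun i _ => by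
        rw [← Matrix.det_transpose]
        exact Ideal.subset_span ⟨fun j => (c (τ (i, j))).2, rfl⟩
      simpa using this
  · rw [← Fin.prod_const, ← Fin.prod_const, Ideal.prod_span, Ideal.prod_span, Ideal.span_mul_span',
      Ideal.span_le]
    rintro _ ⟨x, hx, y, hy, rfl⟩
    obtain ⟨x, hx', rfl⟩ := (Set.mem_fintype_prod _ _).1 hx
    obtain ⟨y, hy', rfl⟩ := (Set.mem_fintype_prod _ _).1 hy
    choose u hu using fun j => Set.mem_range.1 (hx' j)
    choose v hv using fun i => Set.mem_range.1 (hy' i)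
    have h := sum_sign_mul_det_kronecker (fun k i => φ i (u k.2 k.1)) (fun k j => ψ j (v k.1 k.2))
    rw [SetLike.mem_coe, ← Ideal.unit_mul_mem_iff_mem _ hunit]
    have hu' (j) : (Matrix.of fun i i' => φ i' (u j i)).det = x j := by
      rw [← Matrix.det_transpose, ← hu]
      rfl
    have hv' (i) : (Matrix.of fun j j' => ψ j' (v i j)).det = y i := by
      rw [← Matrix.det_transpose, ← hv]
      rfl
    simp only [hu', hv'] at h
    beta_reduce
    rw [← h]
    exact Ideal.sum_mem _ fun α _ => Ideal.sum_mem _ fun β _ => Ideal.mul_mem_left _ _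
      (Ideal.subset_span ⟨fun k => (u k.2 (α k.2 k.1), v k.1 (β k.1 k.2)), rfl⟩)
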